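/- Let I be a nonempty finite set of agents, T ≥ 1 a number of periods, and X : I × {1,…,T} → {x,y} choice data. Then X is rationalizable if and only if X has no cycles. -/

import Mathlib

/-!
Choices are encoded by `Bool`: `true` stands for alternative `x`, `false` for `y`.
Periods are the natural numbers `1, …, T`; `p 0` plays the role of the prior `p₀`.
-/

/-- `X` has a cycle: there are distinct periods `t₁ ≠ t₂` in `{1,…,T}` and agents `i, j`
with `X i t₁ = X j t₂ = x` and `X i t₂ = X j t₁ = y`. -/
def HasCycle {I : Type*} (T : ℕ) (X : I → ℕ → Bool) : Prop :=
  ∃ t₁ ∈ Finset.Icc 1 T, ∃ t₂ ∈ Finset.Icc 1 T, t₁ ≠ t₂ ∧ ∃ i j : I,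
    X i t₁ = true ∧ X j t₂ = true ∧ X i t₂ = false ∧ X j t₁ = false

/-- `X` is rationalizable: there are thresholds `u : I → [0,1]`, beliefs
`p : {0,…,T} → [0,1]` (with `p 0` the prior), transition probabilities
`γxx t = γ_t(ω_x|ω_x)`, `γxy t = γ_t(ω_x|ω_y)` in `[0,1]`, and realized-signal
likelihoods `a t, b t ∈ [0,1]` not both zero, such that each `p t` is obtained from
`p (t-1)` by Bayes' rule (with strictly positive denominator), and for every agent `i`
and period `t ∈ {1,…,T}`: `p t > u i` if `X i t = x`, and `p t < u i` if `X i t = y`. -/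
def Rationalizable {I : Type*} (T : ℕ) (X : I → ℕ → Bool) : Prop :=
  ∃ (u : I → ℝ) (p : ℕ → ℝ) (γxx γxy a b : ℕ → ℝ),
    (∀ i, u i ∈ Set.Icc (0:ℝ) 1) ∧
    (∀ t ≤ T, p t ∈ Set.Icc (0:ℝ) 1) ∧
    (∀ t ∈ Finset.Icc 1 T,
      γxx t ∈ Set.Icc (0:ℝ) 1 ∧ γxy t ∈ Set.Icc (0:ℝ) 1 ∧
      a t ∈ Set.Icc (0:ℝ) 1 ∧ b t ∈ Set.Icc (0:ℝ) 1 ∧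
      ¬(a t = 0 ∧ b t = 0) ∧
      0 < (p (t-1) * γxx t + (1 - p (t-1)) * γxy t) * a t
          + (1 - (p (t-1) * γxx t + (1 - p (t-1)) * γxy t)) * b t ∧
      p t = (p (t-1) * γxx t + (1 - p (t-1)) * γxy t) * a t /
          ((p (t-1) * γxx t + (1 - p (t-1)) * γxy t) * a t
            + (1 - (p (t-1) * γxx t + (1 - p (t-1)) * γxy t)) * b t)) ∧
    (∀ i, ∀ t ∈ Finset.Icc 1 T,
      (X i t = true → u i < p t) ∧ (X i t = false → p t < u i))

/-- Rationalizable data has no cycles. -/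
theorem Rationalizable.not_hasCycle {I : Type*} {T : ℕ} {X : I → ℕ → Bool}
    (h : Rationalizable T X) : ¬ HasCycle T X := by
  obtain ⟨u, p, -, -, -, -, -, -, -, hX⟩ := h
  rintro ⟨t₁, h₁, t₂, h₂, -, i, j, hi₁, hj₂, hi₂, hj₁⟩
  have := (hX i t₁ h₁).1 hi₁
  have := (hX i t₂ h₂).2 hi₂
  have := (hX j t₂ h₂).1 hj₂
  have := (hX j t₁ h₁).2 hj₁
  linarith

/-- Any belief path is feasible: let the state be redrawn every period, independently of the
past, and take uninformative signals. -/
theorem rationalizable_of_beliefs {I : Type*} {T : ℕ} {X : I → ℕ → Bool} (u : I → ℝ) (p : ℕ → ℝ)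
    (hu : ∀ i, u i ∈ Set.Icc (0 : ℝ) 1) (hp : ∀ t, p t ∈ Set.Icc (0 : ℝ) 1)
    (hX : ∀ i, ∀ t ∈ Finset.Icc 1 T,
      (X i t = true → u i < p t) ∧ (X i t = false → p t < u i)) :
    Rationalizable T X := by
  refine ⟨u, p, p, p, fun _ => 1, fun _ => 1, hu, fun t _ => hp t, fun t _ => ?_, hX⟩
  have hq : p (t - 1) * p t + (1 - p (t - 1)) * p t = p t := by ring
  simp [hq, (hp t).1, (hp t).2]

/-- The number of agents choosing `x` in period `t`. -/
def supportCard {I : Type*} [Fintype I] (X : I → ℕ → Bool) (t : ℕ) : ℕ :=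
  (Finset.univ.filter fun i => X i t = true).card

/-- Without cycles, an agent who chooses `x` in one period and `y` in another does so only if
more agents choose `x` in the former. -/
theorem supportCard_lt_of_not_hasCycle {I : Type*} [Fintype I] {T : ℕ} {X : I → ℕ → Bool}
    (h : ¬ HasCycle T X) {s t : ℕ} (hs : s ∈ Finset.Icc 1 T) (ht : t ∈ Finset.Icc 1 T) {i : I}
    (his : X i s = false) (hit : X i t = true) : supportCard X s < supportCard X t := by
  apply Finset.card_lt_card
  rw [Finset.ssubset_iff_of_subset]
  · exact ⟨i, by simp [hit], by simp [his]⟩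
  · intro j hj
    simp only [Finset.mem_filter, Finset.mem_univ, true_and] at hj ⊢
    by_contra hjt
    refine h ⟨t, ht, s, hs, ?_, i, j, hit, hj, his, by simpa using hjt⟩
    rintro rfl
    simp [his] at hit

/-- Data without cycles is rationalizable. -/
theorem rationalizable_of_not_hasCycle {I : Type*} [Fintype I] {T : ℕ} {X : I → ℕ → Bool}
    (h : ¬ HasCycle T X) : Rationalizable T X := by
  let c : I → ℕ := fun i =>
    ((Finset.Icc 1 T).filter fun t => X i t = false).sup fun t => supportCard X t + 1
  have hn : ∀ t, supportCard X t ≤ Fintype.card I := fun t => Finset.card_le_univ _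
  have hc : ∀ i, c i ≤ Fintype.card I + 1 := fun i =>
    Finset.sup_le fun t _ => Nat.succ_le_succ (hn t)
  have hN : (0 : ℝ) < 2 * (Fintype.card I + 2) := by positivity
  refine rationalizable_of_beliefs (fun i => (2 * c i + 1) / (2 * (Fintype.card I + 2)))
    (fun t => (2 * supportCard X t + 2) / (2 * (Fintype.card I + 2)))
    (fun i => ⟨by positivity, ?_⟩) (fun t => ⟨by positivity, ?_⟩)
    fun i t ht => ⟨fun hit => ?_, fun hit => ?_⟩
  · have := hc i
    rw [div_le_one hN]
    norm_cast
    omega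
  · have := hn t
    rw [div_le_one hN]
    norm_cast
    omega
  · have : c i ≤ supportCard X t := Finset.sup_le fun s hs =>
      supportCard_lt_of_not_hasCycle h (Finset.mem_filter.1 hs).1 ht (Finset.mem_filter.1 hs).2 hit
    rw [div_lt_div_iff_of_pos_right hN]
    norm_cast
    omega
  · have : supportCard X t + 1 ≤ c i :=
      Finset.le_sup (f := fun t => supportCard X t + 1) (Finset.mem_filter.2 ⟨ht, hit⟩)
    rw [div_lt_div_iff_of_pos_right hN]
    norm_cast
    omega

/-- **Theorem 1 (baseline characterization).** Choice data is rationalizable if and only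
if it has no cycles. -/
theorem baseline_characterization {I : Type*} [Fintype I] [Nonempty I]
    (T : ℕ) (hT : 1 ≤ T) (X : I → ℕ → Bool) :
    Rationalizable T X ↔ ¬ HasCycle T X := by
  exact ⟨Rationalizable.not_hasCycle, rationalizable_of_not_hasCycle⟩
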